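/- Let R : Fin n → Fin n → Prop be elementary and irreducible with G_R connected and m edges, and set d := m − 2n + 1. If n > d + 1, then every node (upper or lower) of the graph has degree at most 2d − n + 1; if n ≤ d + 1, then every node has degree at most n. -/

import Mathlib

/-- The permutation matrix of `σ`: entry 1 at `(i, σ i)` and 0 elsewhere. -/
def permMat {n : ℕ} (σ : Equiv.Perm (Fin n)) : Matrix (Fin n) (Fin n) ℝ :=
  fun i j => if σ i = j then 1 else 0

/-- `σ` is a (perfect) matching of the bipartite graph of `R`. -/
def IsMatching {n : ℕ} (R : Fin n → Fin n → Prop) (σ : Equiv.Perm (Fin n)) : Prop :=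
  ∀ i, R i (σ i)

/-- `R` is elementary (a face graph): every edge lies in some matching. -/
def IsElementary {n : ℕ} (R : Fin n → Fin n → Prop) : Prop :=
  ∀ i j, R i j → ∃ σ : Equiv.Perm (Fin n), IsMatching R σ ∧ σ i = j

/-- The face of the Birkhoff polytope corresponding to `R`. -/
def face {n : ℕ} (R : Fin n → Fin n → Prop) : Set (Matrix (Fin n) (Fin n) ℝ) :=
  convexHull ℝ {M | ∃ σ : Equiv.Perm (Fin n), IsMatching R σ ∧ M = permMat σ}

/-- The bipartite simple graph `G_R` on `Fin n ⊕ Fin n`, where `Sum.inl i` and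
`Sum.inr j` are adjacent iff `R i j`. -/
def graphOf {n : ℕ} (R : Fin n → Fin n → Prop) : SimpleGraph (Fin n ⊕ Fin n) :=
  SimpleGraph.fromRel (fun a b => ∃ i j, a = Sum.inl i ∧ b = Sum.inr j ∧ R i j)

/-- The degree of the upper node `i`. -/
def upDeg {n : ℕ} (R : Fin n → Fin n → Prop) [∀ i j, Decidable (R i j)] (i : Fin n) : ℕ :=
  Fintype.card {j // R i j}

/-- The degree of the lower node `j`. -/
def loDeg {n : ℕ} (R : Fin n → Fin n → Prop) [∀ i j, Decidable (R i j)] (j : Fin n) : ℕ :=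
  Fintype.card {i // R i j}

/-- The number of edges of the bipartite graph of `R`. -/
def edgeCount {n : ℕ} (R : Fin n → Fin n → Prop) [∀ i j, Decidable (R i j)] : ℕ :=
  Fintype.card {p : Fin n × Fin n // R p.1 p.2}

/-- An upper node `v` of degree 2 with neighbors `w₁ ≠ w₂` is reducible if no `u ≠ v`
is adjacent to both `w₁` and `w₂`. -/
def UpperReducible {n : ℕ} (R : Fin n → Fin n → Prop) (v : Fin n) : Prop :=
  ∃ w₁ w₂ : Fin n, w₁ ≠ w₂ ∧ R v w₁ ∧ R v w₂ ∧ (∀ j, R v j → j = w₁ ∨ j = w₂) ∧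
    ¬ ∃ u, u ≠ v ∧ R u w₁ ∧ R u w₂

/-- Reducibility of lower nodes, defined symmetrically. -/
def LowerReducible {n : ℕ} (R : Fin n → Fin n → Prop) (v : Fin n) : Prop :=
  UpperReducible (fun i j => R j i) v

/-- `R` is irreducible if none of its nodes is reducible. -/
def IrreducibleRel {n : ℕ} (R : Fin n → Fin n → Prop) : Prop :=
  (∀ v, ¬ UpperReducible R v) ∧ (∀ v, ¬ LowerReducible R v)

/-- The face poset of a set `P`: the collection of its faces (convex extreme subsets),
ordered by inclusion. -/
def facesOf {E : Type*} [AddCommGroup E] [Module ℝ E] (P : Set E) : Set (Set E) :=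
  {F | Convex ℝ F ∧ IsExtreme ℝ P F}

open Finset

section FaceGraph

variable {n : ℕ} {R : Fin n → Fin n → Prop}

theorem IsElementary.swap (h : IsElementary R) : IsElementary (fun i j => R j i) := by
  intro i j hij
  obtain ⟨σ, hσ, rfl⟩ := h j i hij
  exact ⟨σ⁻¹, fun k => by simpa using hσ (σ⁻¹ k), by simp⟩

theorem IrreducibleRel.swap (h : IrreducibleRel R) : IrreducibleRel (fun i j => R j i) :=
  ⟨h.2, h.1⟩

theorem graphOf_adj_inl_inr (i j : Fin n) :
    (graphOf R).Adj (Sum.inl i) (Sum.inr j) ↔ R i j := by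
  simp [graphOf]

/-- Exchanging the two sides of the bipartite graph is a graph isomorphism. -/
def graphOfSwapIso (R : Fin n → Fin n → Prop) :
    graphOf R ≃g graphOf (fun i j => R j i) where
  toEquiv := Equiv.sumComm _ _
  map_rel_iff' := by
    rintro (a | a) (b | b) <;> simp [graphOf]

/-- A set of nodes of a connected graph that is closed under adjacency is everything. -/
theorem forall_of_connected_graphOf (hconn : (graphOf R).Connected) (P : Fin n ⊕ Fin n → Prop)
    (hP : ∀ i j, R i j → (P (Sum.inl i) ↔ P (Sum.inr j))) {a : Fin n ⊕ Fin n} (ha : P a)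
    (b : Fin n ⊕ Fin n) : P b := by
  obtain ⟨w⟩ := hconn.preconnected a b
  induction w with
  | nil => exact ha
  | @cons u v _ huv _ ih =>
    refine ih ?_
    rcases u with i | i <;> rcases v with j | j
    · simp [graphOf] at huv
    · exact (hP i j ((graphOf_adj_inl_inr i j).1 huv)).1 ha
    · exact (hP j i ((graphOf_adj_inl_inr j i).1 huv.symm)).2 ha
    · simp [graphOf] at huv

theorem exists_isMatching (hel : IsElementary R) (hconn : (graphOf R).Connected) (a : Fin n) :
    ∃ σ, IsMatching R σ := by
  by_contra hno
  have hR : ∀ i j, ¬ R i j := fun i j hij =>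
    hno ((hel i j hij).imp fun _ h => h.1)
  have := forall_of_connected_graphOf hconn (fun x => x.isLeft)
    (fun i j hij => (hR i j hij).elim) (a := Sum.inl a) rfl (Sum.inr a)
  simp at this

/-- Hall's inequality for a set `S` of upper nodes whose neighbors all lie in `T`. -/
theorem card_le_card_of_neighbors (hel : IsElementary R) (hconn : (graphOf R).Connected)
    {S T : Finset (Fin n)} (hST : ∀ i ∈ S, ∀ j, R i j → j ∈ T) : #S ≤ #T := by
  obtain rfl | ⟨a, -⟩ := S.eq_empty_or_nonempty
  · simp
  obtain ⟨σ, hσ⟩ := exists_isMatching hel hconn a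
  exact card_le_card_of_injOn σ (fun i hi => hST i hi _ (hσ i)) σ.injective.injOn

/-- Hall's inequality is strict for nonempty proper sets of upper nodes. -/
theorem card_lt_card_of_neighbors (hel : IsElementary R) (hconn : (graphOf R).Connected)
    {S T : Finset (Fin n)} (hne : S.Nonempty) (huniv : S ≠ univ)
    (hST : ∀ i ∈ S, ∀ j, R i j → j ∈ T) : #S < #T := by
  by_contra! hle
  obtain ⟨a, ha⟩ := hne
  refine huniv (eq_univ_of_forall fun i => ?_)
  refine forall_of_connected_graphOf hconn (Sum.elim (· ∈ S) (· ∈ T)) ?_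
    (a := Sum.inl a) ha (Sum.inl i)
  refine fun i j hij => ⟨fun hi => hST i hi j hij, fun hj => ?_⟩
  obtain ⟨σ, hσ, rfl⟩ := hel i j hij
  have himage : S.image σ = T := by
    refine eq_of_subset_of_card_le (fun j hj => ?_) ?_
    · obtain ⟨k, hk, rfl⟩ := mem_image.1 hj
      exact hST k hk _ (hσ k)
    · rwa [card_image_of_injective _ σ.injective]
  have hj' : σ i ∈ T := hj
  simpa [← himage] using hj'

theorem upDeg_eq_card_filter [∀ i j, Decidable (R i j)] (i : Fin n) :
    upDeg R i = #{j | R i j} :=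
  Fintype.card_subtype _

theorem edgeCount_eq_sum_upDeg [∀ i j, Decidable (R i j)] :
    edgeCount R = ∑ i, upDeg R i := by
  simp only [edgeCount, upDeg, ← Fintype.card_sigma]
  exact Fintype.card_congr
    ⟨fun p => ⟨p.1.1, p.1.2, p.2⟩, fun s => ⟨(s.1, s.2.1), s.2.2⟩, fun _ => rfl, fun _ => rfl⟩

theorem edgeCount_swap [∀ i j, Decidable (R i j)] :
    edgeCount (fun i j => R j i) = edgeCount R :=
  Fintype.card_congr ((Equiv.prodComm _ _).subtypeEquiv fun _ => Iff.rfl)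

/-- In an irreducible graph, the neighbors of an upper node of degree two are neighbors of another
upper node. -/
theorem IrreducibleRel.exists_partner [∀ i j, Decidable (R i j)] (hirr : IrreducibleRel R)
    {v : Fin n} (hv : upDeg R v = 2) : ∃ u, u ≠ v ∧ ∀ j, R v j → R u j := by
  rw [upDeg_eq_card_filter, card_eq_two] at hv
  obtain ⟨w₁, w₂, hne, hw⟩ := hv
  have hmem : ∀ j, R v j ↔ j = w₁ ∨ j = w₂ := fun j => by
    simpa using Finset.ext_iff.1 hw j
  have hred := hirr.1 v
  by_contra! hno
  refine hred ⟨w₁, w₂, hne, (hmem _).2 (.inl rfl), (hmem _).2 (.inr rfl),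
    fun j => (hmem j).1, ?_⟩
  rintro ⟨u, huv, h₁, h₂⟩
  obtain ⟨j, hj, huj⟩ := hno u huv
  rcases (hmem j).1 hj with rfl | rfl
  exacts [huj h₁, huj h₂]

theorem two_le_upDeg [∀ i j, Decidable (R i j)] (hel : IsElementary R)
    (hconn : (graphOf R).Connected) (hn : 2 ≤ n) (i : Fin n) : 2 ≤ upDeg R i := by
  have hi : ({i} : Finset (Fin n)) ≠ univ := fun h => by
    have := congrArg card h
    simp at this
    omega
  have := card_lt_card_of_neighbors hel hconn (singleton_nonempty i) hi
    (T := {j | R i j}) (by simp)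
  rwa [card_singleton, ← upDeg_eq_card_filter] at this

theorem add_le_edgeCount_of_two_le [∀ i j, Decidable (R i j)] (h : ∀ i, 2 ≤ upDeg R i)
    (i : Fin n) : upDeg R i + 2 * n ≤ edgeCount R + 2 := by
  have hsum := Finset.add_sum_erase univ (upDeg R) (mem_univ i)
  have hrest : #(univ.erase i) • 2 ≤ ∑ j ∈ univ.erase i, upDeg R j :=
    card_nsmul_le_sum _ _ _ fun j _ => h j
  rw [edgeCount_eq_sum_upDeg]
  simp only [card_erase_of_mem (mem_univ i), card_univ, Fintype.card_fin, smul_eq_mul] at hrest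
  omega

/-- With few edges, an upper node of a connected irreducible face graph satisfies
`2 * m ≥ 5 * n + deg - 3`. -/
theorem upDeg_add_le_of_edgeCount_lt [∀ i j, Decidable (R i j)] (hel : IsElementary R)
    (hirr : IrreducibleRel R) (hconn : (graphOf R).Connected) (hm : edgeCount R + 2 < 3 * n)
    (i : Fin n) : upDeg R i + 5 * n ≤ 2 * edgeCount R + 3 := by
  have hn : 2 ≤ n := by
    have hcard := card_le_card_of_neighbors hel hconn (S := {i}) (T := {j | R i j}) (by simp)
    have hle := single_le_sum (f := upDeg R) (fun _ _ => Nat.zero_le _) (mem_univ i)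
    rw [← edgeCount_eq_sum_upDeg, upDeg_eq_card_filter] at hle
    simp only [card_singleton] at hcard
    omega
  have htwo := two_le_upDeg hel hconn hn
  choose! p hp using fun v (hv : upDeg R v = 2) => hirr.exists_partner hv
  let D : Finset (Fin n) := {v | upDeg R v = 2}
  have hfiber : ∀ u, #{v ∈ D | p v = u} + 2 ≤ upDeg R u := by
    intro u
    have hu : u ∉ ({v ∈ D | p v = u} : Finset (Fin n)) := by
      simp only [D, mem_filter, mem_univ, true_and, not_and]
      exact fun h => (hp u h).1
    have hnbr : ∀ k ∈ insert u ({v ∈ D | p v = u} : Finset (Fin n)), ∀ j, R k j →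
        j ∈ ({j | R u j} : Finset (Fin n)) := by
      intro k hk j hkj
      simp only [D, mem_insert, mem_filter, mem_univ, true_and] at hk ⊢
      rcases hk with rfl | ⟨hk, rfl⟩
      exacts [hkj, (hp k hk).2 j hkj]
    have hproper : insert u ({v ∈ D | p v = u} : Finset (Fin n)) ≠ univ := by
      intro h
      have hle := card_le_card_of_neighbors hel hconn hnbr
      rw [h, card_univ, Fintype.card_fin, ← upDeg_eq_card_filter] at hle
      have := add_le_edgeCount_of_two_le htwo u
      omega
    have hlt := card_lt_card_of_neighbors hel hconn (insert_nonempty _ _) hproper hnbr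
    rw [card_insert_of_notMem hu, ← upDeg_eq_card_filter] at hlt
    omega
  have hD : #D + 2 * n ≤ edgeCount R := by
    have := sum_le_sum fun u (_ : u ∈ univ) => hfiber u
    rw [sum_add_distrib, ← card_eq_sum_card_fiberwise fun _ _ => mem_univ _,
      ← edgeCount_eq_sum_upDeg] at this
    simpa [mul_comm] using this
  have hthree : upDeg R i + 3 * n ≤ edgeCount R + #D + 3 := by
    have hDsum : #D = ∑ u, if upDeg R u = 2 then 1 else 0 := card_filter _ _
    have hrest := card_nsmul_le_sum (univ.erase i)
      (fun u => upDeg R u + if upDeg R u = 2 then 1 else 0) 3 fun u _ => by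
        have := htwo u
        split_ifs <;> omega
    have hsum := Finset.add_sum_erase univ
      (fun u => upDeg R u + if upDeg R u = 2 then 1 else 0) (mem_univ i)
    rw [sum_add_distrib (s := univ), ← hDsum, ← edgeCount_eq_sum_upDeg] at hsum
    simp only [card_erase_of_mem (mem_univ i), card_univ, Fintype.card_fin, smul_eq_mul] at hrest
    omega
  omega

end FaceGraph

/-- Maximum degree in a connected irreducible face graph: if `n > d + 1` every node
has degree at most `2d - n + 1` (encoded additively as `deg + n ≤ 2d + 1`), and
otherwise every node has degree at most `n`. Here `d = m - 2n + 1` is encoded by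
`m + 1 = d + 2n`. -/
theorem stmt8 (n : ℕ) (R : Fin n → Fin n → Prop) [∀ i j, Decidable (R i j)]
    (hel : IsElementary R) (hirr : IrreducibleRel R) (hconn : (graphOf R).Connected)
    (d : ℕ) (hd : edgeCount R + 1 = d + 2 * n) :
    (d + 1 < n →
      (∀ i : Fin n, upDeg R i + n ≤ 2 * d + 1) ∧
      (∀ j : Fin n, loDeg R j + n ≤ 2 * d + 1)) ∧
    (n ≤ d + 1 →
      (∀ i : Fin n, upDeg R i ≤ n) ∧
      (∀ j : Fin n, loDeg R j ≤ n)) := by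
  constructor
  · intro hdn
    have hm : edgeCount R + 2 < 3 * n := by omega
    refine ⟨fun i => ?_, fun j => ?_⟩
    · have := upDeg_add_le_of_edgeCount_lt hel hirr hconn hm i
      omega
    · have : loDeg R j + 5 * n ≤ 2 * edgeCount (fun i j => R j i) + 3 :=
        upDeg_add_le_of_edgeCount_lt hel.swap hirr.swap
          ((graphOfSwapIso R).connected_iff.1 hconn) (by rwa [edgeCount_swap]) j
      rw [edgeCount_swap] at this
      omega
  · refine fun _ => ⟨fun i => ?_, fun j => ?_⟩
    · exact (Fintype.card_subtype_le _).trans_eq (Fintype.card_fin n)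
    · exact (Fintype.card_subtype_le _).trans_eq (Fintype.card_fin n)
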